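/- arXiv:2506.24091 — 2 statements merged into one kernel-verified Lean document; each statement's English description precedes it below -/
import Mathlib

section
/- Let R be a regular complete local 2-dimensional integral domain with maximal ideal 𝔪 and fraction field K, let d ≥ 2 be an integer invertible in R, and let f ∈ R be nonzero with irreducible factorization f = f₁^{a₁} ⋯ f_r^{a_r} where gcd(d, a₁, …, a_r) = 1. Set e_i = d / gcd(d, a_i) and let S be the normalization of R in L = K[v]/(v^d − f). If the e_i are not pairwise relatively prime, then S is not regular. -/
section
open IsLocalRing Polynomial

theorem Ideal.le_of_le_sup_maximalIdeal_smul {R : Type*} [CommRing R] [IsLocalRing R]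
    [IsNoetherianRing R] {P N : Ideal R} {z : R} (hz : z ∈ maximalIdeal R)
    (h : ∀ a ∈ P, ∃ b ∈ P, a - z * b ∈ N) : P ≤ N := by
  refine Submodule.le_of_le_smul_of_le_jacobson_bot (I := maximalIdeal R)
    (IsNoetherian.noetherian P) (IsLocalRing.maximalIdeal_le_jacobson _) fun a ha => ?_
  obtain ⟨b, hb, hab⟩ := h a ha
  rw [← sub_add_cancel a (z * b)]
  exact Submodule.add_mem_sup hab (Submodule.smul_mem_smul hz hb)

section
variable {R : Type*} [CommRing R] [IsLocalRing R] [IsNoetherianRing R]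

theorem IsLocalRing.eq_span_singleton_of_isPrime_of_mem {x y : R}
    (hxy : maximalIdeal R = Ideal.span {x, y}) {P : Ideal R} [P.IsPrime]
    (hP : P ≠ maximalIdeal R) (hx : x ∈ P) : P = Ideal.span {x} := by
  have hym : y ∈ maximalIdeal R := hxy ▸ Ideal.subset_span (by simp)
  have hy : y ∉ P := fun hy => hP <| le_antisymm (le_maximalIdeal (Ideal.IsPrime.ne_top ‹_›)) <| by
    rw [hxy, Ideal.span_le]
    rintro z (rfl | rfl) <;> assumption
  refine le_antisymm (Ideal.le_of_le_sup_maximalIdeal_smul hym fun a ha => ?_)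
    ((Ideal.span_singleton_le_iff_mem _).2 hx)
  have ham : a ∈ Ideal.span {x, y} := hxy ▸ le_maximalIdeal (Ideal.IsPrime.ne_top ‹_›) ha
  obtain ⟨b, c, rfl⟩ := Ideal.mem_span_pair.1 ham
  refine ⟨c, ?_, Ideal.mem_span_singleton.2 ⟨b, by ring⟩⟩
  have hcy : c * y ∈ P := by simpa using P.sub_mem ha (P.mul_mem_left b hx)
  exact (Ideal.IsPrime.mem_or_mem ‹_› hcy).resolve_right hy

theorem IsLocalRing.ne_maximalIdeal_of_mem_minimalPrimes_span_singleton
    (hdim : ringKrullDim R = 2) {f : R} {q : Ideal R} (hq : q ∈ (Ideal.span {f}).minimalPrimes) :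
    q ≠ maximalIdeal R := by
  rintro rfl
  have h1 := Ideal.height_le_one_of_isPrincipal_of_mem_minimalPrimes _ _ hq
  have h2 := maximalIdeal_height_eq_ringKrullDim (R := R)
  rw [hdim] at h2
  rw [show (maximalIdeal R).height = 2 from WithBot.coe_injective h2] at h1
  exact absurd h1 (by decide)

theorem IsLocalRing.isPrincipal_of_isPrime_of_ne_maximalIdeal {x y : R}
    (hxy : maximalIdeal R = Ideal.span {x, y}) (hdim : ringKrullDim R = 2) {P : Ideal R}
    [P.IsPrime] (hP : P ≠ maximalIdeal R) : P.IsPrincipal := by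
  by_cases hx : x ∈ P
  · exact ⟨x, eq_span_singleton_of_isPrime_of_mem hxy hP hx⟩
  have hxm : x ∈ maximalIdeal R := hxy ▸ Ideal.subset_span (by simp)
  have hxp : (Ideal.span {x}).IsPrime := by
    obtain ⟨q, hq⟩ := (Ideal.span {x}).nonempty_minimalPrimes
      (by rwa [Ne, Ideal.span_singleton_eq_top])
    have hqp : q.IsPrime := hq.1.1
    have hqm : q ≠ maximalIdeal R := ne_maximalIdeal_of_mem_minimalPrimes_span_singleton hdim hq
    rwa [← eq_span_singleton_of_isPrime_of_mem hxy hqm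
      (hq.1.2 (Ideal.mem_span_singleton_self x))]
  let φ := Ideal.Quotient.mk (Ideal.span {x})
  have hφ : Function.Surjective φ := Ideal.Quotient.mk_surjective
  have : IsLocalRing (R ⧸ Ideal.span {x}) := .of_surjective' φ hφ
  have hmax : maximalIdeal (R ⧸ Ideal.span {x}) = Ideal.span {φ y} := by
    rw [← IsLocalRing.map_maximalIdeal_of_surjective φ hφ, hxy, Ideal.map_span, Set.image_pair,
      Ideal.Quotient.eq_zero_iff_mem.2 (Ideal.mem_span_singleton_self x), Ideal.span_insert_zero]
  have htfae := (tfae_of_isNoetherianRing_of_isLocalRing_of_isDomain (R ⧸ Ideal.span {x})).out 0 4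
  have hpir : IsPrincipalIdealRing (R ⧸ Ideal.span {x}) := htfae.2 ⟨⟨_, hmax⟩⟩
  obtain ⟨w, hw⟩ := (hpir.principal (P.map φ)).principal
  have hwP : w ∈ P.map φ := hw ▸ Ideal.mem_span_singleton_self w
  obtain ⟨p, hp, rfl⟩ := (Ideal.mem_map_iff_of_surjective φ hφ).1 hwP
  refine ⟨p, le_antisymm (Ideal.le_of_le_sup_maximalIdeal_smul hxm fun a ha => ?_)
    ((Ideal.span_singleton_le_iff_mem _).2 hp)⟩
  have ha' : φ a ∈ Ideal.span {φ p} := hw.le (Ideal.mem_map_of_mem φ ha)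
  obtain ⟨c, hc⟩ := Ideal.mem_span_singleton'.1 ha'
  obtain ⟨c, rfl⟩ := hφ c
  rw [← map_mul, eq_comm, Ideal.Quotient.mk_eq_mk_iff_sub_mem, Ideal.mem_span_singleton'] at hc
  obtain ⟨b, hb⟩ := hc
  refine ⟨b, (Ideal.IsPrime.mem_or_mem ‹P.IsPrime› (x := b) (y := x) ?_).resolve_right hx, ?_⟩
  · rw [hb]; exact P.sub_mem ha (P.mul_mem_left c hp)
  · exact Ideal.mem_span_singleton'.2 ⟨c, by linear_combination hb⟩

theorem IsLocalRing.prime_of_irreducible [IsDomain R] {x y : R}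
    (hxy : maximalIdeal R = Ideal.span {x, y}) (hdim : ringKrullDim R = 2) {f : R}
    (hf : Irreducible f) : Prime f := by
  obtain ⟨q, hq⟩ := (Ideal.span {f}).nonempty_minimalPrimes
    (by rw [Ne, Ideal.span_singleton_eq_top]; exact hf.not_isUnit)
  have hqp : q.IsPrime := hq.1.1
  have hqm : q ≠ maximalIdeal R := ne_maximalIdeal_of_mem_minimalPrimes_span_singleton hdim hq
  obtain ⟨p, rfl⟩ := (isPrincipal_of_isPrime_of_ne_maximalIdeal hxy hdim hqm).principal
  have hfp : p ∣ f := Ideal.mem_span_singleton.1 (hq.1.2 (Ideal.mem_span_singleton_self f))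
  have hp0 : p ≠ 0 := by rintro rfl; exact hf.ne_zero (zero_dvd_iff.1 hfp)
  have hp : Prime p := (Ideal.span_singleton_prime hp0).1 hqp
  exact (hf.dvd_iff.1 hfp |>.resolve_left hp.not_isUnit).symm.prime hp
end

section
variable {S : Type*} [CommRing S]

theorem Ideal.mem_span_singleton_sup_of_notMem {n : Ideal S} [n.IsMaximal] {x y α β : S}
    (hx : x ∈ n) (hα : α ∉ n) {J : Ideal S} (hw : α * x + β * y ∈ J) :
    x ∈ (Ideal.span {y} ⊔ J) ⊔ n • n := by
  obtain ⟨γ, m, hm, hγ⟩ := Ideal.IsMaximal.exists_inv ‹n.IsMaximal› hα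
  have hx' : x = (-(γ * β)) * y + γ * (α * x + β * y) + m * x := by linear_combination -x * hγ
  rw [hx']
  exact Submodule.add_mem_sup (Submodule.add_mem_sup
    (Ideal.mul_mem_left _ _ (Ideal.mem_span_singleton_self y)) (J.mul_mem_left _ hw))
    (Submodule.smul_mem_smul hm hx)

theorem Ideal.exists_le_span_singleton_sup {n : Ideal S} [n.IsMaximal] {x y : S}
    (hn : n = Ideal.span {x, y}) {J : Ideal S} (hJ : J ≤ n) (hJn : ¬ J ≤ n • n) :
    ∃ z ∈ n, n ≤ (Ideal.span {z} ⊔ J) ⊔ n • n := by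
  have hx : x ∈ n := hn ▸ Ideal.subset_span (by simp)
  have hy : y ∈ n := hn ▸ Ideal.subset_span (by simp)
  obtain ⟨w, hwJ, hw⟩ := SetLike.not_le_iff_exists.1 hJn
  obtain ⟨α, β, rfl⟩ := Ideal.mem_span_pair.1 (hn ▸ hJ hwJ : w ∈ Ideal.span {x, y})
  have key : ∀ z N, z ∈ (Ideal.span {z} ⊔ J) ⊔ N := fun z N =>
    (le_sup_left.trans le_sup_left : Ideal.span {z} ≤ _) (Ideal.mem_span_singleton_self z)
  by_cases hα : α ∈ n
  · have hβ : β ∉ n := fun hβ => hw (add_mem (Submodule.smul_mem_smul hα hx)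
      (Submodule.smul_mem_smul hβ hy))
    refine ⟨x, hx, ?_⟩
    have := Ideal.mem_span_singleton_sup_of_notMem (n := n) hy hβ (add_comm (α * x) _ ▸ hwJ)
    conv_lhs => rw [hn]
    rw [Ideal.span_le]
    rintro z (rfl | rfl)
    exacts [key _ _, this]
  · refine ⟨y, hy, ?_⟩
    have := Ideal.mem_span_singleton_sup_of_notMem hx hα hwJ
    conv_lhs => rw [hn]
    rw [Ideal.span_le]
    rintro z (rfl | rfl)
    exacts [this, key _ _]

/-- A finite order automorphism of invertible order which acts trivially on `S ⧸ n` and on the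
cotangent space `n ⧸ n ^ 2` is trivial. -/
theorem RingHom.eq_self_of_sub_mem_sq [IsDomain S] [IsNoetherianRing S] {n : Ideal S}
    (hn : n ≠ ⊤) (τ : S →+* S) {d : ℕ} (hτ : ∀ s, τ^[d] s = s) (hd : IsUnit (d : S))
    (hI : ∀ s, τ s - s ∈ n • n) (s : S) : τ s = s := by
  have hIn : Ideal.span (Set.range fun s => τ s - s) ≤ n • n := by
    rw [Ideal.span_le]
    rintro _ ⟨s, rfl⟩
    exact hI s
  set I := Ideal.span (Set.range fun s => τ s - s) with hIdef
  have hmem (s : S) : τ s - s ∈ I := Ideal.subset_span ⟨s, rfl⟩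
  have hnn : n • n ≤ n := Ideal.mul_le_left
  have hδ : ∀ u ∈ n • n, τ u - u ∈ n • I := fun u hu => by
    induction hu using Submodule.smul_induction_on' with
    | smul a ha b hb =>
      have hτa : τ a ∈ n := by simpa using add_mem (hnn (hI a)) ha
      change τ (a * b) - a * b ∈ n • I
      rw [map_mul, show τ a * τ b - a * b = τ a * (τ b - b) + b * (τ a - a) by ring]
      exact add_mem (Submodule.smul_mem_smul hτa (hmem b)) (Submodule.smul_mem_smul hb (hmem a))
    | add a ha b hb iha ihb =>
      rw [map_add, add_sub_add_comm]
      exact add_mem iha ihb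
  have hnI : n • I ≤ n • n := smul_mono_right n (hIn.trans hnn)
  have hiter (s : S) (j : ℕ) : τ^[j] s - s - j * (τ s - s) ∈ n • I := by
    induction j with
    | zero => simp
    | succ j ih =>
      have h1 : τ (τ^[j] s - s - j * (τ s - s)) ∈ n • I := by
        simpa using add_mem (hδ _ (hnI ih)) ih
      have h2 := hδ _ (hI s)
      rw [Function.iterate_succ_apply']
      convert add_mem h1 (Ideal.mul_mem_left _ (j : S) h2) using 1
      simp only [map_sub, map_mul, map_natCast]
      push_cast
      ring
  have hle : I ≤ n • I := by
    rw [hIdef, Ideal.span_le, ← hIdef]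
    rintro _ ⟨s, rfl⟩
    have h := hiter s d
    rw [hτ, sub_self, zero_sub, neg_mem_iff] at h
    exact (Ideal.unit_mul_mem_iff_mem _ hd).1 h
  obtain ⟨r, hr, hrI⟩ := Submodule.exists_sub_one_mem_and_smul_eq_zero_of_fg_of_le_smul n I
    (IsNoetherian.noetherian I) hle
  have hr0 : r ≠ 0 := by
    rintro rfl
    exact hn ((Ideal.eq_top_iff_one n).2 (by simpa using hr))
  exact sub_eq_zero.1 ((mul_eq_zero.1 (hrI _ (hmem s))).resolve_left hr0)

theorem Ideal.le_or_le_of_sub_mem [IsDomain S] [IsNoetherianRing S] {n : Ideal S} [hn : n.IsMaximal]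
    {x y : S} (hxy : n = Ideal.span {x, y}) (τ : S →+* S) {d : ℕ} (hτ : ∀ s, τ^[d] s = s)
    (hd : IsUnit (d : S)) (hne : ∃ s, τ s ≠ s) {P Q : Ideal S} [hP : P.IsPrime] [Q.IsPrime]
    (hPn : P ≤ n) (hQn : Q ≤ n) (hτP : ∀ s, τ s - s ∈ P) (hτQ : ∀ s, τ s - s ∈ Q) :
    P ≤ Q ∨ Q ≤ P := by
  obtain ⟨s, hs⟩ := hne
  obtain ⟨z, hzn, hz⟩ := Ideal.exists_le_span_singleton_sup hxy (J := P ⊓ Q) (inf_le_left.trans hPn)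
    fun h => hs (τ.eq_self_of_sub_mem_sq hn.ne_top hτ hd (fun s => h ⟨hτP s, hτQ s⟩) s)
  obtain ⟨r, hr, hrn⟩ := Submodule.exists_sub_one_mem_and_smul_le_of_fg_of_le_sup
    (IsNoetherian.noetherian n) le_rfl hz
  have hone {t : S} (ht : t - 1 ∈ n) : t ∉ n := fun h =>
    hn.ne_top ((Ideal.eq_top_iff_one n).2 (by simpa using sub_mem h ht))
  have hrmem {a : S} (ha : a ∈ n) : r * a ∈ Ideal.span {z} ⊔ P ⊓ Q :=
    hrn (Submodule.smul_mem_pointwise_smul a r n ha)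
  have hrP : r ∉ P := fun h => hone hr (hPn h)
  by_cases hzP : z ∈ P
  · right
    refine hQn.trans fun a ha => (hP.mem_or_mem ?_).resolve_left hrP
    exact (sup_le ((Ideal.span_singleton_le_iff_mem _).2 hzP) inf_le_left :
      Ideal.span {z} ⊔ P ⊓ Q ≤ P) (hrmem ha)
  · left
    have hle : P ≤ (P ⊓ Q) ⊔ n • P := fun a ha => by
      obtain ⟨u, hu, j, hj, huj⟩ := Submodule.mem_sup.1 (hrmem (hPn ha))
      obtain ⟨b, rfl⟩ := Ideal.mem_span_singleton'.1 hu
      have hb : b ∈ P := by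
        refine (hP.mem_or_mem ?_).resolve_right hzP
        rw [eq_sub_of_add_eq huj]
        exact sub_mem (P.mul_mem_left _ ha) hj.1
      rw [show a = j + (z * b - (r - 1) * a) by linear_combination -huj]
      exact Submodule.add_mem_sup hj
        (sub_mem (Submodule.smul_mem_smul hzn hb) (Submodule.smul_mem_smul hr ha))
    obtain ⟨t, ht, htP⟩ := Submodule.exists_sub_one_mem_and_smul_le_of_fg_of_le_sup
      (IsNoetherian.noetherian P) le_rfl hle
    exact fun a ha => (Ideal.IsPrime.mem_or_mem ‹Q.IsPrime›
      (htP (Submodule.smul_mem_pointwise_smul a t P ha)).2).resolve_left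
      fun h => hone ht (hQn h)
end

theorem IsLocalRing.exists_isPrimitiveRoot {R : Type*} [CommRing R] [IsLocalRing R]
    [IsAdicComplete (maximalIdeal R) R] [IsAlgClosed (ResidueField R)] {d : ℕ} (hd : d ≠ 0)
    (hdu : IsUnit (d : R)) : ∃ ζ : R, IsPrimitiveRoot ζ d := by
  have hd0 : ((d : ℕ) : ResidueField R) ≠ 0 := by
    simpa using (hdu.map (residue R)).ne_zero
  have : NeZero ((d : ℕ) : ResidueField R) := ⟨hd0⟩
  obtain ⟨z, hz⟩ := HasEnoughRootsOfUnity.exists_primitiveRoot (ResidueField R) d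
  obtain ⟨a, rfl⟩ := residue_surjective z
  have hz0 : residue R a ≠ 0 := hz.ne_zero hd
  obtain ⟨ζ, hζ, hζa⟩ := HenselianRing.is_henselian (I := maximalIdeal R) (X ^ d - C 1 : R[X])
    (monic_X_pow_sub_C 1 hd) a (by
      rw [← residue_eq_zero_iff]
      simp [hz.pow_eq_one]) (by
      have : IsUnit (residue R (eval a (derivative (X ^ d - C 1 : R[X])))) := by
        simp [derivative_X_pow, hd0, hz0]
      exact this)
  have hres : residue R ζ = residue R a := by
    rwa [← sub_eq_zero, ← map_sub, residue_eq_zero_iff]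
  refine ⟨ζ, ?_, fun l hl => hz.dvd_of_pow_eq_one l ?_⟩
  · simpa [IsRoot, sub_eq_zero] using hζ
  · rw [← hres, ← map_pow, hl, map_one]

section Kummer
variable {K L : Type*} [Field K] [Field L] [Algebra K L] {d : ℕ} {v : L} {F : K}

theorem minpoly_eq_X_pow_sub_C_of_finrank_eq (hd : d ≠ 0) (hv : v ^ d = algebraMap K L F)
    (hgen : Algebra.adjoin K {v} = ⊤) (hdeg : Module.finrank K L = d) :
    minpoly K v = X ^ d - C F := by
  have : FiniteDimensional K L := .of_finrank_pos (by omega)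
  have hInt : IsIntegral K v := Algebra.IsIntegral.isIntegral v
  have hdim := (PowerBasis.ofAdjoinEqTop hInt hgen).finrank
  rw [hdeg, PowerBasis.ofAdjoinEqTop_dim] at hdim
  refine (Polynomial.eq_of_monic_of_dvd_of_natDegree_le (minpoly.monic hInt)
    (monic_X_pow_sub_C F hd) (minpoly.dvd K v ?_) ?_).symm
  · rw [map_sub, map_pow, aeval_X, aeval_C, hv, sub_self]
  · rw [natDegree_X_pow_sub_C, ← hdim]

theorem exists_algHom_apply_eq_mul (hd : d ≠ 0) (hv : v ^ d = algebraMap K L F)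
    (hgen : Algebra.adjoin K {v} = ⊤) (hdeg : Module.finrank K L = d) {η : K} (hη : η ^ d = 1) :
    ∃ τ : L →ₐ[K] L, τ v = algebraMap K L η * v := by
  have : FiniteDimensional K L := .of_finrank_pos (by omega)
  have hInt : IsIntegral K v := Algebra.IsIntegral.isIntegral v
  refine ⟨(PowerBasis.ofAdjoinEqTop hInt hgen).lift (algebraMap K L η * v) ?_, ?_⟩
  · rw [PowerBasis.ofAdjoinEqTop_gen, minpoly_eq_X_pow_sub_C_of_finrank_eq hd hv hgen hdeg]
    rw [map_sub, map_pow, aeval_X, aeval_C, mul_pow, hv, ← map_pow, hη, map_one, one_mul, sub_self]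
  · simpa using (PowerBasis.ofAdjoinEqTop hInt hgen).lift_gen (S' := L) (algebraMap K L η * v) _

theorem exists_eq_sum_smul_pow (hd : d ≠ 0) (hgen : Algebra.adjoin K {v} = ⊤)
    (hdeg : Module.finrank K L = d) (s : L) : ∃ c : ℕ → K, s = ∑ k ∈ Finset.range d, c k • v ^ k := by
  have : FiniteDimensional K L := .of_finrank_pos (by omega)
  have hInt : IsIntegral K v := Algebra.IsIntegral.isIntegral v
  have hdim := (PowerBasis.ofAdjoinEqTop hInt hgen).finrank
  obtain ⟨p, hp, rfl⟩ := (PowerBasis.ofAdjoinEqTop hInt hgen).exists_eq_aeval s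
  refine ⟨p.coeff, ?_⟩
  rw [PowerBasis.ofAdjoinEqTop_gen, aeval_eq_sum_range' (n := d) (by omega)]

theorem AlgHom.iterate_apply_smul_pow {τ : L →ₐ[K] L} {η : K} (hτ : τ v = algebraMap K L η * v)
    (j k : ℕ) (c : K) : τ^[j] (c • v ^ k) = (η ^ (k * j) * c) • v ^ k := by
  induction j with
  | zero => simp
  | succ j ih =>
    rw [Function.iterate_succ_apply', ih, map_smul, map_pow, hτ, mul_pow, ← map_pow,
      ← Algebra.smul_def, smul_smul]
    congr 1
    ring

theorem AlgHom.iterate_apply_sum {τ : L →ₐ[K] L} {η : K} (hτ : τ v = algebraMap K L η * v)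
    (j : ℕ) (c : ℕ → K) : τ^[j] (∑ k ∈ Finset.range d, c k • v ^ k) =
      ∑ k ∈ Finset.range d, (η ^ (k * j) * c k) • v ^ k := by
  rw [← AlgHom.coe_pow, map_sum, AlgHom.coe_pow]
  exact Finset.sum_congr rfl fun k _ => iterate_apply_smul_pow hτ j k (c k)

theorem isIntegral_smul_pow_of_sum {R : Type*} [CommRing R] [Algebra R K] [Algebra R L]
    [IsScalarTower R K L] {ζ : R} (hζ : IsPrimitiveRoot (algebraMap R K ζ) d)
    (hd : d ≠ 0) (hdu : IsUnit (d : R)) (hv : v ^ d = algebraMap K L F)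
    (hgen : Algebra.adjoin K {v} = ⊤) (hdeg : Module.finrank K L = d) {c : ℕ → K}
    (hs : IsIntegral R (∑ k ∈ Finset.range d, c k • v ^ k)) {k : ℕ} (hk : k < d) :
    IsIntegral R (c k • v ^ k) := by
  obtain ⟨τ, hτ⟩ := exists_algHom_apply_eq_mul hd hv hgen hdeg hζ.pow_eq_one
  have hsum : ∑ j ∈ Finset.range d, ζ ^ ((d - k) * j) • τ^[j] (∑ k ∈ Finset.range d, c k • v ^ k)
      = (d : R) • c k • v ^ k := by
    have hterm (j : ℕ) :
        ζ ^ ((d - k) * j) • τ^[j] (∑ l ∈ Finset.range d, c l • v ^ l) =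
        ∑ l ∈ Finset.range d, ((algebraMap R K ζ ^ (d - k + l)) ^ j * c l) • v ^ l := by
      rw [AlgHom.iterate_apply_sum hτ, Finset.smul_sum]
      refine Finset.sum_congr rfl fun l _ => ?_
      rw [algebra_compatible_smul K, smul_smul, map_pow]
      congr 1
      ring
    simp_rw [hterm]
    rw [Finset.sum_comm, Finset.sum_eq_single_of_mem k (Finset.mem_range.2 hk)]
    · rw [Nat.sub_add_cancel hk.le, hζ.pow_eq_one]
      simp [algebra_compatible_smul K]
    · intro l hl hlk
      rw [← Finset.sum_smul, ← Finset.sum_mul]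
      have hne : algebraMap R K ζ ^ (d - k + l) ≠ 1 := fun h => by
        have hl := Finset.mem_range.1 hl
        obtain ⟨m, hm⟩ := hζ.dvd_of_pow_eq_one _ h
        have : m < 2 := by
          by_contra! h2
          have := Nat.mul_le_mul_left d h2
          omega
        interval_cases m <;> omega
      have hgeom := mul_geom_sum (algebraMap R K ζ ^ (d - k + l)) d
      rw [pow_right_comm, hζ.pow_eq_one, one_pow, sub_self] at hgeom
      rw [(mul_eq_zero.1 hgeom).resolve_left (sub_ne_zero.2 hne), zero_mul, zero_smul]
  have hInt : IsIntegral R ((d : R) • c k • v ^ k) := by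
    rw [← hsum]
    refine IsIntegral.sum _ fun j _ => IsIntegral.smul _ ?_
    rw [← AlgHom.coe_pow]
    exact hs.map ((τ ^ j).restrictScalars R)
  obtain ⟨u, hu⟩ := hdu
  rw [← hu] at hInt
  simpa [smul_smul] using hInt.smul (↑u⁻¹ : R)
end Kummer

theorem Prime.dvd_of_pow_mul_pow_eq {R : Type*} [CommRing R] [IsDomain R] [IsNoetherianRing R]
    {q A B r u : R} {d k a : ℕ} (hq : Prime q) (hu : ¬ q ∣ u) (hd : d ≠ 0)
    (hdk : ¬ d ∣ k * a) (hB : B ≠ 0) (h : A ^ d * (q ^ a * u) ^ k = r * B ^ d) : q ∣ r := by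
  by_contra hr
  have hr0 : r ≠ 0 := by rintro rfl; exact hr (dvd_zero q)
  have hA : A ≠ 0 := by
    rintro rfl
    rw [zero_pow hd, zero_mul] at h
    exact mul_ne_zero hr0 (pow_ne_zero d hB) h.symm
  have hfin {x : R} (hx : x ≠ 0) : FiniteMultiplicity q x :=
    FiniteMultiplicity.of_prime_left hq hx
  have hm := congrArg (emultiplicity q) h
  rw [emultiplicity_mul hq, emultiplicity_mul hq, emultiplicity_pow hq, emultiplicity_pow hq,
    emultiplicity_pow hq, emultiplicity_mul hq, emultiplicity_pow_self hq.ne_zero hq.not_isUnit,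
    emultiplicity_eq_zero.2 hu, emultiplicity_eq_zero.2 hr, (hfin hA).emultiplicity_eq_multiplicity,
    (hfin hB).emultiplicity_eq_multiplicity, zero_add, add_zero] at hm
  have hm' : d * multiplicity q A + k * a = d * multiplicity q B := by exact_mod_cast hm
  exact hdk ((Nat.dvd_add_right (dvd_mul_right d _)).1 (hm' ▸ dvd_mul_right d _))

theorem exists_pow_eq_algebraMap_mul {R K L : Type*} [CommRing R] [IsDomain R] [IsNoetherianRing R]
    [IsIntegrallyClosed R] [Field K] [Field L] [Algebra R K] [IsFractionRing R K] [Algebra K L]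
    [Algebra R L] [IsScalarTower R K L] {q u : R} {d k a : ℕ} {v : L} {c : K} (hq : Prime q)
    (hu : ¬ q ∣ u) (hd : d ≠ 0) (hv : v ^ d = algebraMap R L (q ^ a * u)) (hdk : ¬ d ∣ k * a)
    (hc : IsIntegral R (c • v ^ k)) : ∃ t : R, (c • v ^ k) ^ d = algebraMap R L (q * t) := by
  have hpow : (c • v ^ k) ^ d = algebraMap K L (c ^ d * algebraMap R K ((q ^ a * u) ^ k)) := by
    rw [Algebra.smul_def, mul_pow, pow_right_comm, hv, map_mul (algebraMap K L), map_pow (algebraMap K L),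
      ← IsScalarTower.algebraMap_apply R K L, map_pow (algebraMap R L)]
  have hInt := hc.pow d
  rw [hpow, isIntegral_algebraMap_iff (algebraMap K L).injective] at hInt
  obtain ⟨r, hr⟩ := IsIntegrallyClosed.isIntegral_iff.1 hInt
  obtain ⟨A, B, hB, rfl⟩ := IsFractionRing.div_surjective (A := R) c
  have hB0 : B ≠ 0 := nonZeroDivisors.ne_zero hB
  have hB0' : algebraMap R K B ≠ 0 := by simpa using hB0
  have hqr : q ∣ r := hq.dvd_of_pow_mul_pow_eq (A := A) hu hd hdk hB0 <| by
    apply IsFractionRing.injective R K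
    rw [map_mul, map_mul, hr, map_pow _ A, map_pow _ B, div_pow]
    field_simp
  obtain ⟨t, rfl⟩ := hqr
  exact ⟨t, by rw [hpow, ← hr, ← IsScalarTower.algebraMap_apply]⟩

theorem exists_eq_sum_of_integralClosure {R K L : Type*} [CommRing R] [Field K] [Field L]
    [Algebra R K] [Algebra K L] [Algebra R L] [IsScalarTower R K L] {ζ : R} {F : K} {v : L} {d : ℕ}
    (hζ : IsPrimitiveRoot (algebraMap R K ζ) d) (hd : d ≠ 0) (hdu : IsUnit (d : R))
    (hv : v ^ d = algebraMap K L F) (hgen : Algebra.adjoin K {v} = ⊤)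
    (hdeg : Module.finrank K L = d) (s : integralClosure R L) :
    ∃ (c : ℕ → K) (t : ℕ → integralClosure R L), (∀ k, (t k : L) = c k • v ^ k) ∧
      s = ∑ k ∈ Finset.range d, t k := by
  obtain ⟨c, hc⟩ := exists_eq_sum_smul_pow hd hgen hdeg (s : L)
  have hs : IsIntegral R (∑ k ∈ Finset.range d, c k • v ^ k) := hc ▸ s.2
  have hInt (k : ℕ) : IsIntegral R ((if k < d then c k else 0) • v ^ k) := by
    split_ifs with hk
    · exact isIntegral_smul_pow_of_sum hζ hd hdu hv hgen hdeg hs hk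
    · rw [zero_smul]
      exact isIntegral_zero
  refine ⟨fun k => if k < d then c k else 0, fun k => ⟨_, hInt k⟩, fun k => rfl, ?_⟩
  ext
  rw [hc, AddSubmonoidClass.coe_finsetSum]
  exact Finset.sum_congr rfl fun k hk => by simp [Finset.mem_range.1 hk]

theorem Nat.div_gcd_dvd_of_dvd_mul {d a k : ℕ} (hd : d ≠ 0) (h : d ∣ k * a) :
    d / Nat.gcd d a ∣ k := by
  have hg : 0 < Nat.gcd d a := Nat.gcd_pos_of_pos_left _ (Nat.pos_of_ne_zero hd)
  refine (Nat.coprime_div_gcd_div_gcd hg).dvd_of_dvd_mul_right ?_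
  rw [← Nat.mul_div_assoc _ (Nat.gcd_dvd_right d a)]
  exact Nat.div_dvd_div (Nat.gcd_dvd_left d a) h

end

/-- Let `R` be a regular complete local 2-dimensional integral domain with
maximal ideal `𝔪`, algebraically closed residue field, fraction field `K`, and let `d ≥ 2`
be invertible in `R`.  Let `f = f₁^{a₁} ⋯ f_r^{a_r}` be a nonzero element with irreducible,
pairwise non-associate factors and `gcd(d, a₁, …, a_r) = 1`, set `eᵢ = d/gcd(d, aᵢ)`, and
let `S` be the normalization of `R` in `L = K[v]/(v^d − f)` (encoded: `L` is a field with
`[L : K] = d` generated over `K` by an element `v` with `v^d = f`, and `S` is the integral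
closure of `R` in `L`).  If the `eᵢ` are not pairwise relatively prime, then `S` is not
regular (some maximal ideal of `S` is not generated by two elements). -/
theorem stmt4 (R : Type*) [CommRing R] [IsDomain R] [IsLocalRing R] [IsNoetherianRing R]
    [IsAdicComplete (IsLocalRing.maximalIdeal R) R]
    (hreg : ∃ x y : R, IsLocalRing.maximalIdeal R = Ideal.span {x, y})
    (hdim : ringKrullDim R = 2)
    [IsAlgClosed (IsLocalRing.ResidueField R)]
    (d : ℕ) (hd : 2 ≤ d) (hdu : IsUnit (d : R))
    (K L : Type*) [Field K] [Field L] [Algebra R K] [IsFractionRing R K]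
    [Algebra K L] [Algebra R L] [IsScalarTower R K L]
    (rn : ℕ) (f : Fin rn → R) (a : Fin rn → ℕ)
    (hfi : ∀ i, Irreducible (f i))
    (hfa : ∀ i j, i ≠ j → ¬ Associated (f i) (f j))
    (ha : Nat.gcd d (Finset.univ.gcd a) = 1)
    (F : R) (hF : F = ∏ i, f i ^ a i) (hF0 : F ≠ 0)
    (v : L) (hv : v ^ d = algebraMap R L F)
    (hgen : Algebra.adjoin K {v} = ⊤) (hdeg : Module.finrank K L = d)
    (e : Fin rn → ℕ) (he : ∀ i, e i = d / Nat.gcd d (a i))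
    (hnotcop : ∃ i j, i ≠ j ∧ 1 < Nat.gcd (e i) (e j)) :
    ¬ ∀ I : Ideal (integralClosure R L), I.IsMaximal →
        ∃ x y : integralClosure R L, I = Ideal.span {x, y} := by
  intro h2
  have hd0 : d ≠ 0 := by omega
  obtain ⟨x, y, hxy⟩ := hreg
  have hprime {q : R} (hq : Irreducible q) : Prime q := IsLocalRing.prime_of_irreducible hxy hdim hq
  have : UniqueFactorizationMonoid R := ⟨fun {q} => ⟨hprime, Prime.irreducible⟩⟩
  have : FaithfulSMul R L := (faithfulSMul_iff_algebraMap_injective R L).2 <| by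
    rw [IsScalarTower.algebraMap_eq R K L]
    exact (algebraMap K L).injective.comp (IsFractionRing.injective R K)
  have : FiniteDimensional K L := .of_finrank_pos (by omega)
  have hF0' : algebraMap R L F ≠ 0 := by simpa using hF0
  have hv0 : v ≠ 0 := by
    rintro rfl
    exact hF0' (by rw [← hv, zero_pow hd0])
  have hvK : v ^ d = algebraMap K L (algebraMap R K F) := by
    rw [hv, IsScalarTower.algebraMap_apply R K L]
  obtain ⟨ζ, hζR⟩ := IsLocalRing.exists_isPrimitiveRoot hd0 hdu
  have hζ : IsPrimitiveRoot (algebraMap R K ζ) d := hζR.map_of_injective (IsFractionRing.injective R K)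
  have hsep : Algebra.IsSeparable K L := by
    have hdK : (d : K) ≠ 0 := by simpa using (hdu.map (algebraMap R K)).ne_zero
    have hvs : IsSeparable K v := by
      rw [IsSeparable, minpoly_eq_X_pow_sub_C_of_finrank_eq hd0 hvK hgen hdeg]
      refine Polynomial.separable_X_pow_sub_C _ hdK ?_
      simpa using hF0
    refine ⟨fun w => mem_separableClosure_iff.1 ?_⟩
    have hle : Algebra.adjoin K {v} ≤ (separableClosure K L).toSubalgebra := by
      rw [Algebra.adjoin_le_iff, Set.singleton_subset_iff]
      exact mem_separableClosure_iff.2 hvs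
    exact hle (hgen ▸ Algebra.mem_top)
  have hN : IsNoetherianRing (integralClosure R L) :=
    IsIntegralClosure.isNoetherianRing R K L _
  have hdS : IsUnit (d : integralClosure R L) := by
    simpa using hdu.map (algebraMap R (integralClosure R L))
  have hcomp := exists_eq_sum_of_integralClosure hζ hd0 hdu hvK hgen hdeg
  have hmem (i : Fin rn) {k : ℕ} (hk : ¬ d ∣ k * a i) {c : K} {t : integralClosure R L}
      (ht : (t : L) = c • v ^ k) {P : Ideal (integralClosure R L)} (hP : P.IsPrime)
      (hfP : algebraMap R (integralClosure R L) (f i) ∈ P) : t ∈ P := by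
    have hu : ¬ f i ∣ ∏ j ∈ Finset.univ.erase i, f j ^ a j := fun h => by
      obtain ⟨j, hj, hij⟩ := (hprime (hfi i)).exists_mem_finset_dvd h
      exact hfa i j (Finset.ne_of_mem_erase hj).symm
        ((hfi i).associated_of_dvd (hfi j) ((hprime (hfi i)).dvd_of_dvd_pow hij))
    have hv' := hv
    rw [hF, ← Finset.mul_prod_erase _ _ (Finset.mem_univ i)] at hv'
    obtain ⟨r, hr⟩ := exists_pow_eq_algebraMap_mul (c := c) (hprime (hfi i)) hu hd0 hv' hk (ht ▸ t.2)
    refine hP.mem_of_pow_mem d ?_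
    have : t ^ d = algebraMap R (integralClosure R L) (f i) * algebraMap R _ r := by
      ext
      rw [← map_mul, SubmonoidClass.coe_pow, ht, hr]
      rfl
    rw [this]
    exact P.mul_mem_right _ hfP
  have hunder {n : Ideal (integralClosure R L)} (hn : n.IsMaximal) :
      n.comap (algebraMap R (integralClosure R L)) = IsLocalRing.maximalIdeal R :=
    IsLocalRing.eq_maximalIdeal (Ideal.isMaximal_comap_of_isIntegral_of_isMaximal n)
  have hzero (s : integralClosure R L) : ∃ r : R, ∀ n : Ideal (integralClosure R L), n.IsMaximal →
      s - algebraMap R _ r ∈ n := by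
    obtain ⟨c, t, ht, rfl⟩ := hcomp s
    have ht0 := ht 0
    have hc0 : IsIntegral R (algebraMap K L (c 0)) := by
      have := (t 0).2
      rw [ht0, pow_zero, ← Algebra.algebraMap_eq_smul_one] at this
      exact this
    rw [isIntegral_algebraMap_iff (algebraMap K L).injective] at hc0
    obtain ⟨r, hr⟩ := IsIntegrallyClosed.isIntegral_iff.1 hc0
    refine ⟨r, fun n hn => ?_⟩
    have : t 0 = algebraMap R _ r := by
      ext
      rw [ht0, pow_zero, ← Algebra.algebraMap_eq_smul_one, ← hr,
        ← IsScalarTower.algebraMap_apply R K L]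
      rfl
    rw [← this, ← Finset.add_sum_erase _ _ (Finset.mem_range.2 (Nat.pos_of_ne_zero hd0)),
      add_sub_cancel_left]
    refine sum_mem fun k hk => ?_
    obtain ⟨hk0, hkd⟩ := Finset.mem_erase.1 hk
    obtain ⟨i, hi⟩ : ∃ i, ¬ d ∣ k * a i := by
      by_contra! hall
      have hdvd : d ∣ k * Finset.univ.gcd a := by
        rw [← normalize_eq k, ← Finset.gcd_mul_left]
        exact Finset.dvd_gcd fun i _ => hall i
      exact absurd (Nat.le_of_dvd (Nat.pos_of_ne_zero hk0)
        ((Nat.Coprime.dvd_of_dvd_mul_right ha hdvd))) (not_le.2 (Finset.mem_range.1 hkd))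
    refine hmem i hi (ht k) hn.isPrime ?_
    rw [← Ideal.mem_comap, hunder hn]
    exact (hfi i).not_isUnit
  have huniq {n n' : Ideal (integralClosure R L)} (hn : n.IsMaximal) (hn' : n'.IsMaximal) :
      n = n' := by
    refine hn.eq_of_le hn'.ne_top fun s hs => ?_
    obtain ⟨r, hr⟩ := hzero s
    have hrn : r ∈ n.comap (algebraMap R (integralClosure R L)) := by
      simpa using sub_mem hs (hr n hn)
    rw [hunder hn, ← hunder hn'] at hrn
    simpa using add_mem (hr n' hn') hrn
  obtain ⟨i, j, hij, hgcd⟩ := hnotcop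
  set p := Nat.gcd (e i) (e j) with hp
  have hpi : p ∣ e i := Nat.gcd_dvd_left _ _
  have hpj : p ∣ e j := Nat.gcd_dvd_right _ _
  have hpd : p ∣ d := hpi.trans (he i ▸ Nat.div_dvd_of_dvd (Nat.gcd_dvd_left _ _))
  have hη : (algebraMap R K ζ ^ (d / p)) ^ d = 1 := by
    rw [pow_right_comm, hζ.pow_eq_one, one_pow]
  obtain ⟨τ, hτ⟩ := exists_algHom_apply_eq_mul hd0 hvK hgen hdeg hη
  let τS : integralClosure R L →ₐ[R] integralClosure R L := (τ.restrictScalars R).mapIntegralClosure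
  have hτS (s : integralClosure R L) : (τS s : L) = τ s := rfl
  have hτSiter (s : integralClosure R L) (m : ℕ) : ((τS^[m] s : integralClosure R L) : L) = τ^[m] s := by
    induction m with
    | zero => rfl
    | succ m ih => rw [Function.iterate_succ_apply', Function.iterate_succ_apply', hτS, ih]
  have hτd (s : integralClosure R L) : τS^[d] s = s := by
    obtain ⟨c, hc⟩ := exists_eq_sum_smul_pow hd0 hgen hdeg (s : L)
    ext
    rw [hτSiter, hc, AlgHom.iterate_apply_sum hτ]
    exact Finset.sum_congr rfl fun k _ => by rw [mul_comm k d, pow_mul, hη, one_pow, one_mul]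
  have hτne : ∃ s, τS s ≠ s := by
    have hvint : IsIntegral R v := .of_pow (Nat.pos_of_ne_zero hd0) (hv ▸ isIntegral_algebraMap)
    refine ⟨⟨v, hvint⟩, fun h => ?_⟩
    have h' : τ v = v := congrArg Subtype.val h
    rw [hτ, mul_eq_right₀ hv0, map_eq_one_iff _ (algebraMap K L).injective] at h'
    have hlt := Nat.div_lt_self (Nat.pos_of_ne_zero hd0) hgcd
    have hpos := Nat.div_pos (Nat.le_of_dvd (Nat.pos_of_ne_zero hd0) hpd) (by omega)
    exact absurd (Nat.le_of_dvd hpos (hζ.dvd_of_pow_eq_one _ h')) (not_le.2 hlt)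
  have hτP (l : Fin rn) (hpl : p ∣ e l) {P : Ideal (integralClosure R L)} (hP : P.IsPrime)
      (hfP : algebraMap R (integralClosure R L) (f l) ∈ P) (s : integralClosure R L) :
      τS s - s ∈ P := by
    obtain ⟨c, t, ht, rfl⟩ := hcomp s
    rw [map_sum, ← Finset.sum_sub_distrib]
    refine sum_mem fun k _ => ?_
    have hτt : τS (t k) = algebraMap R _ (ζ ^ (d / p * k)) * t k := by
      ext
      have h1 := AlgHom.iterate_apply_smul_pow hτ 1 k (c k)
      rw [Function.iterate_one] at h1
      rw [hτS, ht, h1, mul_one, ← pow_mul, mul_smul, ← map_pow, algebraMap_smul, Algebra.smul_def,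
        ← ht]
      rfl
    by_cases hpk : p ∣ k
    · obtain ⟨m, rfl⟩ := hpk
      rw [hτt, ← mul_assoc, Nat.div_mul_cancel hpd, pow_mul, hζR.pow_eq_one, one_pow, map_one,
        one_mul, sub_self]
      exact P.zero_mem
    · have htP : t k ∈ P := hmem l
        (fun h => hpk (hpl.trans (he l ▸ Nat.div_gcd_dvd_of_dvd_mul hd0 h))) (ht k) hP hfP
      rw [hτt]
      exact sub_mem (P.mul_mem_left _ htP) htP
  have hover (l : Fin rn) : ∃ P : Ideal (integralClosure R L), P.IsPrime ∧
      ∀ r, algebraMap R (integralClosure R L) r ∈ P ↔ f l ∣ r := by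
    have : (Ideal.span {f l}).IsPrime :=
      (Ideal.span_singleton_prime (hfi l).ne_zero).2 (hprime (hfi l))
    obtain ⟨P, -, hP, hPl⟩ := Ideal.exists_ideal_over_prime_of_isIntegral
      (S := integralClosure R L) (Ideal.span {f l}) ⊥ (by simp [← RingHom.ker_eq_comap_bot])
    exact ⟨P, hP, fun r => by rw [← Ideal.mem_comap, hPl, Ideal.mem_span_singleton]⟩
  obtain ⟨P, hP, hPi⟩ := hover i
  obtain ⟨Q, hQ, hQj⟩ := hover j
  obtain ⟨n, hn, hPn⟩ := P.exists_le_maximal hP.ne_top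
  obtain ⟨n', hn', hQn⟩ := Q.exists_le_maximal hQ.ne_top
  obtain rfl := huniq hn hn'
  obtain ⟨z, w, hzw⟩ := h2 n hn
  have hfP := (hPi (f i)).2 dvd_rfl
  have hfQ := (hQj (f j)).2 dvd_rfl
  rcases Ideal.le_or_le_of_sub_mem hzw (τS : integralClosure R L →+* integralClosure R L) hτd hdS
    hτne hPn hQn (hτP i hpi hP hfP) (hτP j hpj hQ hfQ) with h | h
  · exact hfa i j hij ((hfi j).associated_of_dvd (hfi i) ((hQj _).1 (h hfP))).symm
  · exact hfa i j hij ((hfi i).associated_of_dvd (hfi j) ((hPi _).1 (h hfQ)))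
end

section
/- Let R be a regular complete local 2-dimensional integral domain with maximal ideal 𝔪 and fraction field K, with residue field algebraically closed of characteristic not dividing d ≥ 2. Let f = f₁^{a₁} ⋯ f_r^{a_r} ∈ R with gcd(d, a₁, …, a_r) = 1, set e_i = d/gcd(d, a_i), and suppose the e_i are pairwise relatively prime. Then for each i there is an element v_i in the normalization S of R in K[v]/(v^d − f) satisfying v_i^{e_i} = f_i, and moreover S ≅ R[v₁, …, v_r]/(v₁^{e₁} − f₁, …, v_r^{e_r} − f_r). -/
/-- A principal ideal `(x)` absorbs a finitely generated ideal `I` of a local ring as soon as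
it does so up to `t • I` for some non-unit `t`. -/
theorem Ideal.eq_span_singleton_of_mem_add_mul {R : Type*} [CommRing R] [IsLocalRing R]
    [IsNoetherianRing R] {I : Ideal R} {p t : R} (hp : p ∈ I)
    (ht : t ∈ IsLocalRing.maximalIdeal R)
    (h : ∀ q ∈ I, ∃ r, ∃ s ∈ I, q = p * r + t * s) : I = Ideal.span {p} := by
  refine le_antisymm ?_ ((Ideal.span_singleton_le_iff_mem _).2 hp)
  refine Submodule.le_of_le_smul_of_le_jacobson_bot (I := Ideal.span {t})
    (IsNoetherian.noetherian I) ?_ ?_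
  · rw [IsLocalRing.jacobson_eq_maximalIdeal _ bot_ne_top]
    exact (Ideal.span_singleton_le_iff_mem _).2 ht
  · intro q hq
    obtain ⟨r, s, hs, rfl⟩ := h q hq
    refine Submodule.add_mem_sup (Ideal.mul_mem_right _ _ (Ideal.mem_span_singleton_self p)) ?_
    exact Submodule.smul_mem_smul (Ideal.mem_span_singleton_self t) hs

/-- In a two-dimensional Noetherian local domain with maximal ideal `(x, y)`, the element `x`
is prime. -/
theorem prime_of_maximalIdeal_eq_span_pair {R : Type*} [CommRing R] [IsDomain R]
    [IsLocalRing R] [IsNoetherianRing R] {x y : R}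
    (hxy : IsLocalRing.maximalIdeal R = Ideal.span {x, y}) (hdim : ringKrullDim R = 2) :
    Prime x := by
  have hheight : (IsLocalRing.maximalIdeal R).height = 2 := by
    have := IsLocalRing.maximalIdeal_height_eq_ringKrullDim (R := R)
    rw [hdim] at this
    exact WithBot.coe_injective this
  have hxm : x ∈ IsLocalRing.maximalIdeal R := by
    rw [hxy]; exact Ideal.subset_span (by simp)
  have hym : y ∈ IsLocalRing.maximalIdeal R := by
    rw [hxy]; exact Ideal.subset_span (by simp)
  have hne : ∀ z : R, IsLocalRing.maximalIdeal R ∉ (Ideal.span {z}).minimalPrimes := by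
    intro z hz
    have := Ideal.height_le_one_of_isPrincipal_of_mem_minimalPrimes _ _ hz
    rw [hheight] at this
    exact absurd this (by decide)
  obtain ⟨Q, hQ, hQm⟩ := Ideal.exists_minimalPrimes_le
    ((Ideal.span_singleton_le_iff_mem _).2 hxm)
  have hQp : Q.IsPrime := hQ.1.1
  have hxQ : x ∈ Q := (Ideal.span_singleton_le_iff_mem _).1 hQ.1.2
  have hyQ : y ∉ Q := by
    intro hyQ
    have : IsLocalRing.maximalIdeal R ≤ Q := by
      rw [hxy, Ideal.span_le]
      rintro z (rfl | rfl) <;> assumption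
    exact hne x (le_antisymm hQm this ▸ hQ)
  have hQx : Q = Ideal.span {x} := by
    refine Ideal.eq_span_singleton_of_mem_add_mul hxQ hym fun q hq => ?_
    obtain ⟨a, b, rfl⟩ := Ideal.mem_span_pair.1 (hxy ▸ hQm hq)
    refine ⟨a, b, ?_, by ring⟩
    have : b * y ∈ Q := (Q.add_mem_iff_right (Q.mul_mem_left a hxQ)).1 hq
    exact (hQp.mem_or_mem this).resolve_right hyQ
  have hx0 : x ≠ 0 := by
    rintro rfl
    refine hne y ?_
    have : Ideal.span {0, y} = Ideal.span {y} := Ideal.span_insert_zero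
    rw [hxy, this, ← hxy.trans this, Ideal.minimalPrimes_eq_subsingleton_self]
    rfl
  exact (Ideal.span_singleton_prime hx0).1 (hQx ▸ hQp)

/-- A two-dimensional regular local domain is a unique factorization domain. -/
theorem uniqueFactorizationMonoid_of_maximalIdeal_eq_span_pair {R : Type*} [CommRing R]
    [IsDomain R] [IsLocalRing R] [IsNoetherianRing R] {x y : R}
    (hxy : IsLocalRing.maximalIdeal R = Ideal.span {x, y}) (hdim : ringKrullDim R = 2) :
    UniqueFactorizationMonoid R := by
  have hx : Prime x := prime_of_maximalIdeal_eq_span_pair hxy hdim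
  have hxm : x ∈ IsLocalRing.maximalIdeal R := hx.not_isUnit
  have : (Ideal.span {x}).IsPrime := (Ideal.span_singleton_prime hx.ne_zero).2 hx
  have : IsLocalRing (R ⧸ Ideal.span {x}) :=
    IsLocalRing.of_surjective' _ Ideal.Quotient.mk_surjective
  have hprin : (IsLocalRing.maximalIdeal (R ⧸ Ideal.span {x})).IsPrincipal := by
    rw [← IsLocalRing.map_maximalIdeal_of_surjective _ Ideal.Quotient.mk_surjective, hxy,
      Ideal.map_span, Set.image_pair, Ideal.Quotient.eq_zero_iff_mem.2
        (Ideal.mem_span_singleton_self x), Ideal.span_insert_zero]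
    exact ⟨_, rfl⟩
  have hpir : IsPrincipalIdealRing (R ⧸ Ideal.span {x}) :=
    ((tfae_of_isNoetherianRing_of_isLocalRing_of_isDomain _).out 4 0).1 hprin
  refine UniqueFactorizationMonoid.iff_exists_prime_mem_of_isPrime.2 fun P hP0 hP => ?_
  by_cases hxP : x ∈ P
  · exact ⟨x, hxP, hx⟩
  obtain ⟨p', hp'⟩ := (hpir.principal (P.map (Ideal.Quotient.mk (Ideal.span {x})))).principal
  obtain ⟨p, hpP, rfl⟩ := (Ideal.mem_map_iff_of_surjective _ Ideal.Quotient.mk_surjective).1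
    (hp' ▸ Submodule.mem_span_singleton_self p')
  have hPp : P = Ideal.span {p} := by
    refine Ideal.eq_span_singleton_of_mem_add_mul hpP hxm fun q hq => ?_
    have hq' := Ideal.mem_map_of_mem (Ideal.Quotient.mk (Ideal.span {x})) hq
    rw [hp', Submodule.mem_span_singleton] at hq'
    obtain ⟨r', hr'⟩ := hq'
    obtain ⟨r, rfl⟩ := Ideal.Quotient.mk_surjective r'
    rw [smul_eq_mul, ← map_mul, eq_comm, Ideal.Quotient.eq, Ideal.mem_span_singleton'] at hr'
    obtain ⟨s, hs⟩ := hr'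
    refine ⟨r, s, ?_, by linear_combination -hs⟩
    have : s * x ∈ P := hs ▸ P.sub_mem hq (P.mul_mem_left r hpP)
    exact (hP.mem_or_mem this).resolve_right hxP
  have hp0 : p ≠ 0 := by
    rintro rfl
    exact hP0 (by simpa using hPp)
  exact ⟨p, hpP, (Ideal.span_singleton_prime hp0).1 (hPp ▸ hP)⟩

/-- A complete local ring with algebraically closed residue field in which `d` is invertible
contains a primitive `d`-th root of unity. -/
theorem exists_isPrimitiveRoot_of_isAdicComplete {R : Type*} [CommRing R] [IsLocalRing R]
    [IsAdicComplete (IsLocalRing.maximalIdeal R) R] [IsAlgClosed (IsLocalRing.ResidueField R)]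
    {d : ℕ} (hd : 0 < d) (hdu : IsUnit (d : R)) : ∃ ζ : R, IsPrimitiveRoot ζ d := by
  have hdu' : IsUnit (d : IsLocalRing.ResidueField R) := by
    simpa using hdu.map (IsLocalRing.residue R)
  have : NeZero (d : IsLocalRing.ResidueField R) := ⟨hdu'.ne_zero⟩
  obtain ⟨ξ, hξ⟩ := HasEnoughRootsOfUnity.exists_primitiveRoot (IsLocalRing.ResidueField R) d
  obtain ⟨z, rfl⟩ := IsLocalRing.residue_surjective ξ
  have hzu : IsUnit z := isUnit_of_map_unit (IsLocalRing.residue R) z (hξ.isUnit hd.ne')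
  obtain ⟨ζ, hζ, hζz⟩ := HenselianRing.is_henselian (I := IsLocalRing.maximalIdeal R)
    (Polynomial.X ^ d - 1) (by simpa using Polynomial.monic_X_pow_sub_C (1 : R) hd.ne') z
    (by
      rw [← IsLocalRing.residue_eq_zero_iff]
      simp [hξ.pow_eq_one])
    (by
      refine IsUnit.map _ ?_
      simpa [Polynomial.derivative_X_pow] using ⟨hdu, hzu.pow (d - 1)⟩)
  have hres : IsLocalRing.residue R ζ = IsLocalRing.residue R z := by
    rwa [← sub_eq_zero, ← map_sub, IsLocalRing.residue_eq_zero_iff]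
  refine ⟨ζ, ?_, fun l hl => hξ.dvd_of_pow_eq_one l ?_⟩
  · simpa [sub_eq_zero] using hζ
  · rw [← hres, ← map_pow, hl, map_one]

/-- A Kummer extension has an automorphism multiplying the radical by a root of unity. -/
theorem exists_algHom_radical_eq_mul {K L : Type*} [Field K] [Field L] [Algebra K L] {d : ℕ}
    (hd : 0 < d) {F : K} {v : L} (hv : v ^ d = algebraMap K L F)
    (hgen : Algebra.adjoin K {v} = ⊤) (hdeg : Module.finrank K L = d) {ζ : K}
    (hζ : ζ ^ d = 1) : ∃ σ : L →ₐ[K] L, σ v = algebraMap K L ζ * v := by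
  have hmonic : (Polynomial.X ^ d - Polynomial.C F).Monic :=
    Polynomial.monic_X_pow_sub_C F hd.ne'
  have hroot : Polynomial.aeval v (Polynomial.X ^ d - Polynomial.C F) = 0 := by simp [hv]
  have hint : IsIntegral K v := ⟨_, hmonic, hroot⟩
  obtain ⟨pb, hgen'⟩ : ∃ pb : PowerBasis K L, pb.gen = v :=
    ⟨_, PowerBasis.ofAdjoinEqTop_gen hint hgen⟩
  have hmin : minpoly K v = Polynomial.X ^ d - Polynomial.C F := by
    symm
    refine Polynomial.eq_of_monic_of_dvd_of_natDegree_le (minpoly.monic hint) hmonic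
      (minpoly.dvd _ _ hroot) ?_
    rw [Polynomial.natDegree_X_pow_sub_C, ← hgen', pb.natDegree_minpoly, ← pb.finrank, hdeg]
  have hlift : Polynomial.aeval (algebraMap K L ζ * v) (minpoly K pb.gen) = 0 := by
    rw [hgen', hmin, map_sub, map_pow, Polynomial.aeval_X, Polynomial.aeval_C, mul_pow,
      ← map_pow, hζ, map_one, one_mul, hv, sub_self]
  exact ⟨pb.lift _ hlift, by simpa only [hgen'] using pb.lift_gen _ hlift⟩

section Exponents

variable {ι : Type*} {d : ℕ} {a e : ι → ℕ}

theorem div_gcd_dvd_of_ne (he : ∀ i, e i = d / Nat.gcd d (a i))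
    (hcop : ∀ i j, i ≠ j → Nat.gcd (e i) (e j) = 1) {i j : ι} (hij : i ≠ j) : e i ∣ a j := by
  have h : e i ∣ d := he i ▸ Nat.div_dvd_of_dvd (Nat.gcd_dvd_left _ _)
  have hj : d.gcd (a j) * e j = d := by
    rw [he j, Nat.mul_div_cancel' (Nat.gcd_dvd_left _ _)]
  rw [← hj] at h
  exact (Nat.Coprime.dvd_of_dvd_mul_right (hcop i j hij) h).trans (Nat.gcd_dvd_right _ _)

variable [Fintype ι]

theorem prod_div_gcd_eq (ha : Nat.gcd d (Finset.univ.gcd a) = 1)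
    (he : ∀ i, e i = d / Nat.gcd d (a i)) (hcop : ∀ i j, i ≠ j → Nat.gcd (e i) (e j) = 1) :
    ∏ i, e i = d := by
  refine Nat.dvd_antisymm ?_ ?_
  · refine Finset.prod_dvd_of_isRelPrime (fun i _ j _ hij => ?_) fun i _ => ?_
    · exact Nat.coprime_iff_isRelPrime.1 (hcop i j hij)
    · rw [he i]
      exact Nat.div_dvd_of_dvd (Nat.gcd_dvd_left _ _)
  · have h : d ∣ Finset.univ.gcd fun i => a i * ∏ j, e j := by
      refine Finset.dvd_gcd fun i _ => ?_
      refine dvd_trans ?_ (mul_dvd_mul_left (a i) (Finset.dvd_prod_of_mem e (Finset.mem_univ i)))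
      obtain ⟨b, hb⟩ := Nat.gcd_dvd_right d (a i)
      refine ⟨b, ?_⟩
      conv_lhs => rw [hb]
      rw [he i, mul_right_comm, Nat.mul_div_cancel' (Nat.gcd_dvd_left _ _)]
    rw [Finset.gcd_mul_right, normalize_eq] at h
    exact Nat.Coprime.dvd_of_dvd_mul_left ha h

theorem coprime_div_gcd (ha : Nat.gcd d (Finset.univ.gcd a) = 1)
    (he : ∀ i, e i = d / Nat.gcd d (a i)) (hcop : ∀ i j, i ≠ j → Nat.gcd (e i) (e j) = 1)
    (i : ι) : (a i).Coprime (e i) := by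
  have h : e i ∣ d := he i ▸ Nat.div_dvd_of_dvd (Nat.gcd_dvd_left _ _)
  refine Nat.eq_one_of_dvd_one ?_
  rw [← ha]
  refine Nat.dvd_gcd ((Nat.gcd_dvd_right _ _).trans h) (Finset.dvd_gcd fun j _ => ?_)
  by_cases hij : i = j
  · exact hij ▸ Nat.gcd_dvd_left _ _
  · exact (Nat.gcd_dvd_right _ _).trans (div_gcd_dvd_of_ne he hcop hij)

/-- Roots `wᵢ` of the `fᵢ` exist in a field containing a `d`-th root `v` of `∏ fᵢ ^ aᵢ`, and
an automorphism fixing the `fᵢ` and scaling `v` by a primitive root of unity scales the `wᵢ` by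
primitive roots of unity. -/
theorem exists_pow_eq_of_prod_pow {K L : Type*} [Field K] [Field L] [Algebra K L]
    {f : ι → K} (hf : ∀ i, f i ≠ 0) (hprod : ∏ i, e i = d)
    (hdvd : ∀ i j, i ≠ j → e i ∣ a j) (hcop : ∀ i, (a i).Coprime (e i)) (hd : 0 < d)
    {v : L} (hv : v ^ d = algebraMap K L (∏ i, f i ^ a i)) {ζ : K} (hζ : IsPrimitiveRoot ζ d)
    {σ : L →ₐ[K] L} (hσ : σ v = algebraMap K L ζ * v) (i : ι) :
    ∃ (w : L) (μ : K), w ^ e i = algebraMap K L (f i) ∧ IsPrimitiveRoot μ (e i) ∧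
      σ w = algebraMap K L μ * w := by
  classical
  obtain ⟨D, hD⟩ : e i ∣ d := hprod ▸ Finset.dvd_prod_of_mem e (Finset.mem_univ i)
  obtain ⟨k, m, hkm⟩ : IsCoprime (a i : ℤ) (e i : ℤ) := Nat.isCoprime_iff_coprime.2 (hcop i)
  have hm : ∀ j, ∃ n : ℤ, k * a j = (if j = i then 1 else 0) + e i * n := by
    intro j
    by_cases hij : j = i
    · subst hij
      exact ⟨-m, by rw [if_pos rfl]; linear_combination hkm⟩
    · obtain ⟨b, hb⟩ := hdvd i j (Ne.symm hij)
      exact ⟨k * b, by rw [if_neg hij, hb]; push_cast; ring⟩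
  choose n hn using hm
  have hfL : ∀ j, algebraMap K L (f j) ≠ 0 := fun j => by simpa using hf j
  refine ⟨v ^ (D * k) * algebraMap K L (∏ j, f j ^ (-n j)), ζ ^ (D * k), ?_, ?_, ?_⟩
  · have h1 : (v ^ (D * k)) ^ e i = (v ^ d) ^ k := by
      rw [hD, ← zpow_natCast, ← zpow_natCast, ← zpow_mul, ← zpow_mul]
      congr 1
      push_cast; ring
    rw [mul_pow, h1, hv, ← map_pow, ← map_zpow₀, ← map_mul, ← Finset.prod_zpow,
      ← Finset.prod_pow, ← Finset.prod_mul_distrib]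
    congr 1
    rw [Finset.prod_eq_single i]
    · rw [← zpow_natCast, ← zpow_natCast, ← zpow_mul, ← zpow_mul, ← zpow_add₀ (hf i)]
      have := hn i
      rw [if_pos rfl] at this
      rw [show (a i : ℤ) * k + -n i * e i = 1 by linear_combination this, zpow_one]
    · intro j _ hj
      rw [← zpow_natCast, ← zpow_natCast, ← zpow_mul, ← zpow_mul, ← zpow_add₀ (hf j)]
      have := hn j
      rw [if_neg hj] at this
      rw [show (a j : ℤ) * k + -n j * e i = 0 by linear_combination this, zpow_zero]
    · simp
  · rw [zpow_mul, zpow_natCast]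
    refine (hζ.pow hd (hD.trans (mul_comm _ _))).zpow_of_gcd_eq_one k ?_
    exact Int.isCoprime_iff_gcd_eq_one.1 ⟨a i, m, by linear_combination hkm⟩
  · rw [map_mul, map_zpow₀, hσ, mul_zpow, map_zpow₀, σ.commutes, mul_assoc]

/-- Products of powers of primitive roots of unity of pairwise coprime orders are distinct. -/
theorem injective_prod_pow_of_isPrimitiveRoot {M : Type*} [CommMonoid M] {μ : ι → M}
    (hμ : ∀ i, IsPrimitiveRoot (μ i) (e i)) (hcop : ∀ i j, i ≠ j → Nat.gcd (e i) (e j) = 1) :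
    Function.Injective fun α : (i : ι) → Fin (e i) => ∏ i, μ i ^ (α i : ℕ) := by
  classical
  intro α β h
  funext i
  set D := ∏ j ∈ Finset.univ.erase i, e j
  have key : ∀ γ : (i : ι) → Fin (e i),
      (∏ j, μ j ^ (γ j : ℕ)) ^ D = (μ i ^ D) ^ (γ i : ℕ) := by
    intro γ
    rw [← Finset.prod_pow, Finset.prod_eq_single i]
    · rw [← pow_mul, ← pow_mul, mul_comm]
    · intro j _ hj
      obtain ⟨c, hc⟩ : e j ∣ D := Finset.dvd_prod_of_mem e (by simpa using hj)
      rw [hc, pow_right_comm, pow_mul, (hμ j).pow_eq_one, one_pow, one_pow]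
    · simp
  have hDi : D.Coprime (e i) :=
    Nat.Coprime.prod_left fun j hj => hcop j i (Finset.ne_of_mem_erase hj)
  have h' := congrArg (· ^ D) h
  simp only [key] at h'
  exact Fin.ext (((hμ i).pow_of_coprime D hDi).pow_inj (α i).2 (β i).2 h')

end Exponents

/-- If eigenvectors of an automorphism `σ` have distinct `d`-th roots of unity as eigenvalues,
then each term of an integral linear combination of them is integral. -/
theorem IsIntegral.eigenvector_component {R K L ι : Type*} [CommRing R] [Field K] [Field L]
    [Algebra R K] [Algebra K L] [Algebra R L] [IsScalarTower R K L] [Fintype ι] {d : ℕ}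
    (hd : 0 < d) (hdu : IsUnit (d : R)) {σ : L →ₐ[K] L} {W : ι → L} {χ : ι → K}
    (hχ : Function.Injective χ) (hχd : ∀ i, χ i ^ d = 1)
    (hσ : ∀ i, σ (W i) = algebraMap K L (χ i) * W i) {c : ι → K}
    (hx : IsIntegral R (∑ i, c i • W i)) (i : ι) : IsIntegral R (c i • W i) := by
  classical
  have hpow : ∀ (m : ℕ) (j : ι), (σ ^ m) (W j) = χ j ^ m • W j := by
    intro m j
    induction m with
    | zero => simp
    | succ m ih =>
      rw [pow_succ, AlgHom.mul_apply, hσ, map_mul, AlgHom.commutes, ih, Algebra.smul_def,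
        Algebra.smul_def, pow_succ, map_mul]
      ring
  have hχ0 : ∀ j, χ j ≠ 0 := fun j h => by
    have := hχd j
    rw [h, zero_pow hd.ne'] at this
    exact zero_ne_one this
  have horth : ∀ j, ∑ m ∈ Finset.range d, ((χ i)⁻¹ * χ j) ^ m = if j = i then (d : K) else 0 := by
    intro j
    split_ifs with hij
    · subst hij
      simp [inv_mul_cancel₀ (hχ0 j)]
    · have h1 : 1 - (χ i)⁻¹ * χ j ≠ 0 := by
        intro h
        refine hij (hχ ?_)
        have := hχ0 i
        field_simp at h
        linear_combination -h
      refine (mul_eq_zero.1 ?_).resolve_left h1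
      rw [mul_neg_geom_sum, mul_pow, inv_pow, hχd, hχd]
      simp
  have hsum : ∑ m ∈ Finset.range d, algebraMap K L ((χ i)⁻¹ ^ m) * (σ ^ m) (∑ j, c j • W j)
      = algebraMap R L d * (c i • W i) := by
    have : ∀ m, algebraMap K L ((χ i)⁻¹ ^ m) * (σ ^ m) (∑ j, c j • W j)
        = ∑ j, ((χ i)⁻¹ * χ j) ^ m • (c j • W j) := by
      intro m
      rw [map_sum, Finset.mul_sum]
      refine Finset.sum_congr rfl fun j _ => ?_
      rw [map_smul, hpow]
      simp only [Algebra.smul_def, mul_pow, map_mul]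
      ring
    simp only [this]
    rw [Finset.sum_comm]
    simp only [← Finset.sum_smul, horth, ite_smul, zero_smul, Finset.sum_ite_eq',
      Finset.mem_univ, if_true]
    simp [Algebra.smul_def]
  have hint : IsIntegral R (algebraMap R L d * (c i • W i)) := by
    rw [← hsum]
    refine IsIntegral.sum _ fun m _ => IsIntegral.mul ?_ (hx.map ((σ ^ m).restrictScalars R))
    refine IsIntegral.of_pow hd ?_
    rw [← map_pow, ← pow_mul, mul_comm, pow_mul, inv_pow, hχd]
    simpa using isIntegral_one
  obtain ⟨u, hu⟩ := hdu
  have : c i • W i = algebraMap R L ↑u⁻¹ * (algebraMap R L d * (c i • W i)) := by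
    rw [← mul_assoc, ← map_mul, ← hu, Units.inv_mul, map_one, one_mul]
  rw [this]
  exact isIntegral_algebraMap.mul hint

/-- Denominators cannot be cancelled by monomials in primes with exponents less than `d`. -/
theorem isInteger_of_pow_mul_prod_pow {R K ι : Type*} [CommRing R] [IsDomain R]
    [UniqueFactorizationMonoid R] [Field K] [Algebra R K] [IsFractionRing R K] [Fintype ι]
    {f : ι → R} (hfi : ∀ i, Irreducible (f i)) (hfa : ∀ i j, i ≠ j → ¬ Associated (f i) (f j))
    {d : ℕ} (hd : d ≠ 0) {b : ι → ℕ} (hb : ∀ i, b i < d) {c : K}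
    (hc : IsIntegral R (c ^ d * algebraMap R K (∏ i, f i ^ b i))) :
    IsLocalization.IsInteger R c := by
  classical
  obtain ⟨r, hr⟩ := IsIntegrallyClosed.isIntegral_iff.1 hc
  set p := IsFractionRing.num R c
  set q : R := (IsFractionRing.den R c : R)
  have hq0 : q ≠ 0 := nonZeroDivisors.ne_zero (IsFractionRing.den R c).2
  have hcpq : c * algebraMap R K q = algebraMap R K p := by
    have := IsFractionRing.mk'_num_den' R c
    rw [div_eq_iff (by simp)] at this
    exact this.symm
  have heq : p ^ d * ∏ i, f i ^ b i = r * q ^ d := by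
    apply IsFractionRing.injective R K
    rw [map_mul, map_mul, map_pow, map_pow, hr, ← hcpq]
    ring
  have hrel : IsRelPrime (q ^ d) (p ^ d) := (IsFractionRing.num_den_reduced R c).symm.pow
  have hdvd : q ^ d ∣ ∏ i, f i ^ b i := hrel.dvd_of_dvd_mul_left ⟨r, by rw [heq, mul_comm]⟩
  refine IsFractionRing.isInteger_of_isUnit_den ?_
  by_contra hqu
  obtain ⟨π, hπ, hπq⟩ := WfDvdMonoid.exists_irreducible_factor hqu hq0
  have hπf : π ∣ ∏ i, f i ^ b i := (hπq.trans (dvd_pow_self q hd)).trans hdvd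
  obtain ⟨i, -, hi⟩ := hπ.prime.exists_mem_finset_dvd hπf
  have hfq : f i ∣ q :=
    ((hπ.associated_of_dvd (hfi i) (hπ.prime.dvd_of_dvd_pow hi)).symm.dvd).trans hπq
  have h1 : f i ^ b i * f i ^ (d - b i) ∣ f i ^ b i * ∏ j ∈ Finset.univ.erase i, f j ^ b j := by
    rw [← pow_add, Nat.add_sub_cancel' (hb i).le,
      Finset.mul_prod_erase Finset.univ (fun j => f j ^ b j) (Finset.mem_univ i)]
    exact (pow_dvd_pow_of_dvd hfq d).trans hdvd
  have h2 := (mul_dvd_mul_iff_left (pow_ne_zero _ (hfi i).ne_zero)).1 h1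
  have h3 := (dvd_pow_self (f i) (Nat.sub_ne_zero_of_lt (hb i))).trans h2
  obtain ⟨j, hj, hij⟩ := (hfi i).prime.exists_mem_finset_dvd h3
  exact hfa i j (Finset.ne_of_mem_erase hj).symm
    ((hfi i).associated_of_dvd (hfi j) ((hfi i).prime.dvd_of_dvd_pow hij))

/-- Modulo the relations `Xᵢ ^ eᵢ = fᵢ`, every polynomial is a linear combination of monomials
whose exponents are bounded by the `eᵢ`. -/
theorem MvPolynomial.exists_sub_mem_span_X_pow_sub_C {R ι : Type*} [CommRing R] [Fintype ι]
    [DecidableEq ι] (f : ι → R) {e : ι → ℕ} (he : ∀ i, 0 < e i) (p : MvPolynomial ι R) :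
    ∃ c : ((i : ι) → Fin (e i)) → R,
      p - ∑ α, c α • ∏ i, (MvPolynomial.X i : MvPolynomial ι R) ^ (α i : ℕ) ∈
        Ideal.span (Set.range fun i => MvPolynomial.X i ^ e i - MvPolynomial.C (f i)) := by
  set I := Ideal.span (Set.range fun i => MvPolynomial.X i ^ e i - MvPolynomial.C (f i))
  induction p using MvPolynomial.induction_on' with
  | monomial s r =>
    let β : (i : ι) → Fin (e i) := fun i => ⟨s i % e i, Nat.mod_lt _ (he i)⟩
    refine ⟨Pi.single β (r * ∏ i, f i ^ (s i / e i)), ?_⟩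
    rw [Finset.sum_eq_single β (fun γ _ hγ => by simp [hγ]) (by simp), Pi.single_eq_same,
      ← Ideal.Quotient.eq, MvPolynomial.monomial_eq, Finsupp.prod_fintype _ _ (by simp),
      MvPolynomial.smul_eq_C_mul]
    have hX : ∀ i, Ideal.Quotient.mk I (MvPolynomial.X i ^ e i)
        = Ideal.Quotient.mk I (MvPolynomial.C (f i)) :=
      fun i => Ideal.Quotient.eq.2 (Ideal.subset_span ⟨i, rfl⟩)
    simp only [map_mul, map_prod, mul_assoc, ← Finset.prod_mul_distrib]
    congr 1
    refine Finset.prod_congr rfl fun i _ => ?_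
    conv_lhs => rw [← Nat.div_add_mod (s i) (e i)]
    rw [pow_add, pow_mul, map_mul, map_pow, hX]
    simp [β]
  | add p q hp hq =>
    obtain ⟨c, hc⟩ := hp
    obtain ⟨c', hc'⟩ := hq
    refine ⟨c + c', ?_⟩
    convert I.add_mem hc hc' using 1
    simp only [Pi.add_apply, add_smul, Finset.sum_add_distrib]
    ring

/-- Same setup as Statement 4 (`R` regular complete local 2-dimensional
domain, algebraically closed residue field of characteristic prime to `d ≥ 2`,
`f = f₁^{a₁} ⋯ f_r^{a_r}` with `gcd(d, a₁, …, a_r) = 1`, `eᵢ = d/gcd(d, aᵢ)`), and suppose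
the `eᵢ` are pairwise relatively prime.  Then there are elements `wᵢ` in the normalization
`S` of `R` in `L = K[v]/(v^d − f)` with `wᵢ^{eᵢ} = fᵢ` and `L = K(w₁, …, w_r)`; moreover
`S ≅ R[w₁, …, w_r]/(w₁^{e₁} − f₁, …, w_r^{e_r} − f_r)` (presented as an `R`-algebra map from
a multivariate polynomial ring with image `S` and kernel the expected ideal). -/
theorem stmt5 (R : Type*) [CommRing R] [IsDomain R] [IsLocalRing R] [IsNoetherianRing R]
    [IsAdicComplete (IsLocalRing.maximalIdeal R) R]
    (hreg : ∃ x y : R, IsLocalRing.maximalIdeal R = Ideal.span {x, y})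
    (hdim : ringKrullDim R = 2)
    [IsAlgClosed (IsLocalRing.ResidueField R)]
    (d : ℕ) (hd : 2 ≤ d) (hdu : IsUnit (d : R))
    (K L : Type*) [Field K] [Field L] [Algebra R K] [IsFractionRing R K]
    [Algebra K L] [Algebra R L] [IsScalarTower R K L]
    (rn : ℕ) (f : Fin rn → R) (a : Fin rn → ℕ)
    (hfi : ∀ i, Irreducible (f i))
    (hfa : ∀ i j, i ≠ j → ¬ Associated (f i) (f j))
    (ha : Nat.gcd d (Finset.univ.gcd a) = 1)
    (F : R) (hF : F = ∏ i, f i ^ a i) (hF0 : F ≠ 0)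
    (v : L) (hv : v ^ d = algebraMap R L F)
    (hgen : Algebra.adjoin K {v} = ⊤) (hdeg : Module.finrank K L = d)
    (e : Fin rn → ℕ) (he : ∀ i, e i = d / Nat.gcd d (a i))
    (hcop : ∀ i j, i ≠ j → Nat.gcd (e i) (e j) = 1) :
    ∃ w : Fin rn → L,
      (∀ i, w i ∈ integralClosure R L ∧ w i ^ e i = algebraMap R L (f i)) ∧
      Algebra.adjoin K (Set.range w) = ⊤ ∧
      ∃ ψ : MvPolynomial (Fin rn) R →ₐ[R] L,
        (∀ i, ψ (MvPolynomial.X i) = w i) ∧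
        ψ.range = integralClosure R L ∧
        RingHom.ker ψ =
          Ideal.span (Set.range fun i : Fin rn =>
            MvPolynomial.X i ^ e i - MvPolynomial.C (f i)) := by
  obtain ⟨x, y, hxy⟩ := hreg
  have hUFD := uniqueFactorizationMonoid_of_maximalIdeal_eq_span_pair hxy hdim
  have hd0 : 0 < d := by omega
  obtain ⟨ζ, hζ⟩ := exists_isPrimitiveRoot_of_isAdicComplete hd0 hdu
  replace hζ := hζ.map_of_injective (IsFractionRing.injective R K)
  have hfK : ∀ i, algebraMap R K (f i) ≠ 0 := fun i => by simpa using (hfi i).ne_zero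
  have hvK : v ^ d = algebraMap K L (∏ i, algebraMap R K (f i) ^ a i) := by
    simp only [hv, hF, ← map_pow, ← map_prod, ← IsScalarTower.algebraMap_apply]
  obtain ⟨σ, hσ⟩ := exists_algHom_radical_eq_mul hd0 hvK hgen hdeg hζ.pow_eq_one
  have hprod : ∏ i, e i = d := prod_div_gcd_eq ha he hcop
  have hed : ∀ i, e i ∣ d := fun i => hprod ▸ Finset.dvd_prod_of_mem e (Finset.mem_univ i)
  have he0 : ∀ i, 0 < e i := fun i => Nat.pos_of_dvd_of_pos (hed i) hd0
  choose w μ hw hμ hσw using exists_pow_eq_of_prod_pow hfK hprod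
    (fun i j => div_gcd_dvd_of_ne he hcop) (coprime_div_gcd ha he hcop) hd0 hvK hζ hσ
  have hwf : ∀ i, w i ^ e i = algebraMap R L (f i) := fun i => by
    rw [hw, ← IsScalarTower.algebraMap_apply]
  have hwint : ∀ i, w i ∈ integralClosure R L := fun i =>
    IsIntegral.of_pow (he0 i) (hwf i ▸ isIntegral_algebraMap)
  have hw0 : ∀ i, w i ≠ 0 := fun i h => by
    have := hw i
    rw [h, zero_pow (he0 i).ne'] at this
    exact hfK i (by simpa using this.symm)
  let W : ((i : Fin rn) → Fin (e i)) → L := fun α => ∏ i, w i ^ (α i : ℕ)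
  let χ : ((i : Fin rn) → Fin (e i)) → K := fun α => ∏ i, μ i ^ (α i : ℕ)
  have hχ : Function.Injective χ := injective_prod_pow_of_isPrimitiveRoot hμ hcop
  have hχd : ∀ α, χ α ^ d = 1 := fun α => by
    simp only [χ, ← Finset.prod_pow]
    refine Finset.prod_eq_one fun i _ => ?_
    rw [pow_right_comm, ((hμ i).pow_eq_one_iff_dvd d).2 (hed i), one_pow]
  have hσW : ∀ α, σ (W α) = algebraMap K L (χ α) * W α := fun α => by
    simp only [W, χ, map_prod, map_pow, hσw, mul_pow, Finset.prod_mul_distrib]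
  have hW0 : ∀ α, W α ≠ 0 := fun α => Finset.prod_ne_zero_iff.2 fun i _ => pow_ne_zero _ (hw0 i)
  have hli : LinearIndependent K W :=
    Module.End.eigenvectors_linearIndependent' σ.toLinearMap χ hχ W fun α =>
      Module.End.hasEigenvector_iff.2 ⟨Module.End.mem_eigenspace_iff.2 (by
        rw [Algebra.smul_def]; exact hσW α), hW0 α⟩
  have hspan : Submodule.span K (Set.range W) = ⊤ := by
    have : FiniteDimensional K L := Module.finite_of_finrank_pos (hdeg ▸ hd0)
    exact hli.span_eq_top_of_card_eq_finrank' (by simp [hdeg, hprod])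
  have hint : ∀ c : ((i : Fin rn) → Fin (e i)) → K, IsIntegral R (∑ α, c α • W α) →
      ∀ α, ∃ r : R, algebraMap R K r = c α := by
    intro c hc α
    have h := (hc.eigenvector_component hd0 hdu hχ hχd hσW α).pow d
    refine isInteger_of_pow_mul_prod_pow hfi hfa hd0.ne' (b := fun i => d / e i * α i)
      (fun i => ?_) ?_
    · calc d / e i * α i < d / e i * e i :=
            Nat.mul_lt_mul_of_pos_left (α i).2 (Nat.div_pos (Nat.le_of_dvd hd0 (hed i)) (he0 i))
        _ = d := Nat.div_mul_cancel (hed i)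
    · refine (isIntegral_algebraMap_iff (algebraMap K L).injective).1 ?_
      convert h using 1
      rw [Algebra.smul_def, mul_pow, map_mul, map_pow, ← IsScalarTower.algebraMap_apply, map_prod,
        ← Finset.prod_pow]
      congr 1
      refine Finset.prod_congr rfl fun i _ => ?_
      rw [map_pow, ← hwf, ← pow_mul, ← pow_mul, ← mul_assoc, Nat.mul_div_cancel' (hed i), mul_comm]
  have hψW : ∀ c : ((i : Fin rn) → Fin (e i)) → R,
      MvPolynomial.aeval w
          (∑ α, c α • ∏ i, (MvPolynomial.X i : MvPolynomial (Fin rn) R) ^ (α i : ℕ))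
        = ∑ α, algebraMap R K (c α) • W α := by
    intro c
    simp [W]
  refine ⟨w, fun i => ⟨hwint i, hwf i⟩, ?_, MvPolynomial.aeval w, MvPolynomial.aeval_X w, ?_, ?_⟩
  · rw [← Algebra.toSubmodule_eq_top, eq_top_iff, ← hspan, Submodule.span_le]
    rintro _ ⟨α, rfl⟩
    exact (Algebra.adjoin K (Set.range w)).prod_mem fun i _ =>
      pow_mem (Algebra.subset_adjoin (Set.mem_range_self i)) _
  · refine le_antisymm ?_ fun z hz => ?_
    · rw [← Algebra.adjoin_range_eq_range_aeval, Algebra.adjoin_le_iff]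
      rintro _ ⟨i, rfl⟩
      exact hwint i
    · obtain ⟨c, rfl⟩ := (Submodule.mem_span_range_iff_exists_fun K).1
        (hspan ▸ Submodule.mem_top : z ∈ Submodule.span K (Set.range W))
      choose r hr using hint c hz
      exact ⟨_, (hψW r).trans (by simp only [hr])⟩
  · have hle : Ideal.span (Set.range fun i : Fin rn =>
        MvPolynomial.X i ^ e i - MvPolynomial.C (f i)) ≤
          RingHom.ker (MvPolynomial.aeval w : MvPolynomial (Fin rn) R →ₐ[R] L) := by
      rw [Ideal.span_le]
      rintro _ ⟨i, rfl⟩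
      simp [RingHom.mem_ker, hwf]
    refine le_antisymm (fun p hp => ?_) hle
    obtain ⟨c, hc⟩ := MvPolynomial.exists_sub_mem_span_X_pow_sub_C f he0 p
    have h0 := RingHom.mem_ker.1 (hle hc)
    rw [map_sub, RingHom.mem_ker.1 hp, zero_sub, neg_eq_zero, hψW] at h0
    have hc0 : ∀ α, c α = 0 := fun α => by
      simpa using Fintype.linearIndependent_iff.1 hli _ h0 α
    simpa [hc0] using hc
end
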